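/- Let n, m be positive integers with m ≤ n, let L : Fin n → ℝ be antitone, let F : ℕ → ℝ be monotone and nonnegative, and let T ≥ 0. Then the minimum, over all partitions of Fin n into exactly m nonempty blocks, of the makespan max over blocks g of F(card g) · (max of L over g) · T, is equal to the minimum of the same quantity taken only over partitions of Fin n into exactly m nonempty blocks each of which is a contiguous interval of indices. -/

import Mathlib

open Finset

/-- Cost of a single block `g`: interference factor `F (card g)` times the maximum
trajectory length in `g`, times the base per-token time `T`. -/
noncomputable def blockCost {n : ℕ} (L : Fin n → ℝ) (F : ℕ → ℝ) (T : ℝ)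
    (g : Finset (Fin n)) : ℝ :=
  if h : g.Nonempty then F g.card * g.sup' h L * T else 0

/-- Makespan of a partition: the maximum block cost over its parts. -/
noncomputable def makespan {n : ℕ} (L : Fin n → ℝ) (F : ℕ → ℝ) (T : ℝ)
    (P : Finpartition (univ : Finset (Fin n))) : ℝ :=
  if h : P.parts.Nonempty then P.parts.sup' h (blockCost L F T) else 0

/-- A partition is contiguous if every block is an interval `{a, a+1, …, b}` of indices. -/
def Contiguous {n : ℕ} (P : Finpartition (univ : Finset (Fin n))) : Prop :=
  ∀ g ∈ P.parts, ∃ a b : Fin n, a ≤ b ∧ g = Finset.Icc a b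

theorem Finpartition.card_parts_eq_card_image {α β : Type*} [Fintype α] [DecidableEq α]
    [DecidableEq β] (P : Finpartition (univ : Finset α)) (f : α → β)
    (hP : P.parts = univ.image fun i => ({j | f j = f i} : Finset α)) :
    P.parts.card = (univ.image f).card := by
  have h : P.parts = (univ.image f).image fun v => ({j | f j = v} : Finset α) := by
    rw [hP, image_image]
    rfl
  rw [h, card_image_of_injOn]
  intro v hv w _ hvw
  obtain ⟨i, -, rfl⟩ := mem_image.1 (mem_coe.1 hv)
  have hi : i ∈ ({j | f j = f i} : Finset α) := by simp
  rw [show ({j | f j = f i} : Finset α) = ({j | f j = w} : Finset α) from hvw] at hi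
  exact (mem_filter.1 hi).2

/-- Every partition of a finite linear order is given by the fibers of the function sending an
element to the minimum of its block. -/
theorem Finpartition.exists_fiber_min {α : Type*} [Fintype α] [LinearOrder α]
    (P : Finpartition (univ : Finset α)) :
    ∃ f : α → α, (∀ i, f i ≤ i) ∧ (∀ i, f (f i) = f i) ∧
      P.parts = univ.image fun i => ({j | f j = f i} : Finset α) := by
  have hmem (i : α) : i ∈ P.part i := P.mem_part (mem_univ i)
  have hpart {i j : α} (h : j ∈ P.part i) : P.part j = P.part i :=
    P.part_eq_of_mem (P.part_mem.2 (mem_univ i)) h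
  let f : α → α := fun i => (P.part i).min' ⟨i, hmem i⟩
  have hf (i : α) : f i ∈ P.part i := min'_mem _ _
  have hcongr {i j : α} (h : P.part j = P.part i) : f j = f i := by
    simp only [f, h]
  have hfiber (i : α) : ({j | f j = f i} : Finset α) = P.part i := by
    ext j
    simp only [mem_filter, mem_univ, true_and]
    refine ⟨fun h => ?_, fun h => hcongr (hpart h)⟩
    rw [← hpart (hf i), ← h, hpart (hf j)]
    exact hmem j
  refine ⟨f, fun i => min'_le _ _ (hmem i), fun i => hcongr (hpart (hf i)), ?_⟩
  simp only [hfiber]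
  ext s
  simp only [mem_image, mem_univ, true_and]
  constructor
  · intro hs
    obtain ⟨i, hi⟩ := P.nonempty_of_mem_parts hs
    exact ⟨i, P.part_eq_of_mem hs hi⟩
  · rintro ⟨i, rfl⟩
    exact P.part_mem.2 (mem_univ i)

/-- If `f i ≤ i` for all `i`, then a sorted rearrangement `f ∘ σ` also satisfies this bound. -/
theorem Fin.comp_perm_le_self_of_monotone {n : ℕ} {f : Fin n → Fin n} (hf : ∀ i, f i ≤ i)
    (σ : Equiv.Perm (Fin n)) (hσ : Monotone (f ∘ σ)) (c : Fin n) : f (σ c) ≤ c := by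
  have h₁ : Iio (f (σ c)) ⊆ (Iio c).image σ := by
    intro j hj
    refine mem_image.2 ⟨σ.symm j, mem_Iio.2 ?_, σ.apply_symm_apply j⟩
    apply hσ.reflect_lt
    simpa using (hf j).trans_lt (mem_Iio.1 hj)
  have h₂ := (card_le_card h₁).trans card_image_le
  simpa using h₂

theorem Finset.exists_eq_Icc_of_fiber {α β : Type*} [LinearOrder α] [Fintype α]
    [LocallyFiniteOrder α] [PartialOrder β] [DecidableEq β] {g : α → β} (hg : Monotone g) (i : α) :
    ∃ a b : α, a ≤ b ∧ ({j | g j = g i} : Finset α) = Icc a b := by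
  have hne : ({j | g j = g i} : Finset α).Nonempty := ⟨i, by simp⟩
  have ha := (mem_filter.1 (min'_mem _ hne)).2
  have hb := (mem_filter.1 (max'_mem _ hne)).2
  refine ⟨_, _, min'_le_max' _ hne, ?_⟩
  ext j
  refine ⟨fun hj => mem_Icc.2 ⟨min'_le _ _ hj, le_max' _ _ hj⟩, fun hj => ?_⟩
  obtain ⟨h₁, h₂⟩ := mem_Icc.1 hj
  exact mem_filter.2 ⟨mem_univ _, le_antisymm ((hg h₂).trans_eq hb) (ha.symm.trans_le (hg h₁))⟩

theorem makespan_le_makespan {n : ℕ} {L : Fin n → ℝ} {F : ℕ → ℝ} {T : ℝ}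
    {P Q : Finpartition (univ : Finset (Fin n))} (hcard : Q.parts.card = P.parts.card)
    (h : ∀ t ∈ Q.parts, ∃ s ∈ P.parts, blockCost L F T t ≤ blockCost L F T s) :
    makespan L F T Q ≤ makespan L F T P := by
  unfold makespan
  by_cases hQ : Q.parts.Nonempty
  · have hP : P.parts.Nonempty := card_pos.1 (hcard ▸ card_pos.2 hQ)
    rw [dif_pos hQ, dif_pos hP]
    refine sup'_le _ _ fun t ht => ?_
    obtain ⟨s, hs, hts⟩ := h t ht
    exact hts.trans (le_sup' _ hs)
  · have hP : ¬ P.parts.Nonempty := fun hP => hQ (card_pos.1 (hcard ▸ card_pos.2 hP))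
    rw [dif_neg hQ, dif_neg hP]

theorem blockCost_le_blockCost {n : ℕ} {L : Fin n → ℝ} (hL : Antitone L) {F : ℕ → ℝ}
    (hF : ∀ k, 0 ≤ F k) {T : ℝ} (hT : 0 ≤ T) {s t : Finset (Fin n)} (hcard : t.card = s.card)
    {v : Fin n} (hv : v ∈ s) (hvt : ∀ c ∈ t, v ≤ c) :
    blockCost L F T t ≤ blockCost L F T s := by
  have hs : s.Nonempty := ⟨v, hv⟩
  have ht : t.Nonempty := card_pos.1 (hcard ▸ card_pos.2 hs)
  rw [blockCost, blockCost, dif_pos hs, dif_pos ht, hcard]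
  have hsup : t.sup' ht L ≤ s.sup' hs L :=
    sup'_le _ _ fun c hc => (hL (hvt c hc)).trans (le_sup' L hv)
  exact mul_le_mul_of_nonneg_right (mul_le_mul_of_nonneg_left hsup (hF _)) hT

/-- Listing the blocks by increasing minimum and laying them out consecutively, with the same
sizes, does not increase the makespan. -/
theorem exists_contiguous_makespan_le {n : ℕ} {L : Fin n → ℝ} (hL : Antitone L) {F : ℕ → ℝ}
    (hF : ∀ k, 0 ≤ F k) {T : ℝ} (hT : 0 ≤ T) (P : Finpartition (univ : Finset (Fin n))) :
    ∃ Q : Finpartition (univ : Finset (Fin n)),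
      Q.parts.card = P.parts.card ∧ Contiguous Q ∧ makespan L F T Q ≤ makespan L F T P := by
  obtain ⟨f, hf, hff, hP⟩ := P.exists_fiber_min
  let σ := Tuple.sort f
  have hσ : Monotone (f ∘ σ) := Tuple.monotone_sort f
  let Q : Finpartition (univ : Finset (Fin n)) :=
    @Finpartition.ofSetoid _ _ _ (Setoid.ker (f ∘ σ))
      (fun i j => inferInstanceAs (Decidable (f (σ i) = f (σ j))))
  have hQ : Q.parts = univ.image fun i => ({j | (f ∘ σ) j = (f ∘ σ) i} : Finset (Fin n)) := by
    ext t
    simp only [Q, Finpartition.ofSetoid, Finpartition.ofSetSetoid, mem_image, mem_univ,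
      true_and, eq_comm]
    rfl
  have hcard : Q.parts.card = P.parts.card := by
    rw [Q.card_parts_eq_card_image _ hQ, P.card_parts_eq_card_image f hP, ← image_image,
      image_univ_equiv]
  refine ⟨Q, hcard, fun t ht => ?_, makespan_le_makespan hcard fun t ht => ?_⟩
  · rw [hQ] at ht
    obtain ⟨i, -, rfl⟩ := mem_image.1 ht
    exact exists_eq_Icc_of_fiber hσ i
  · rw [hQ] at ht
    obtain ⟨i, -, rfl⟩ := mem_image.1 ht
    refine ⟨_, hP ▸ mem_image_of_mem _ (mem_univ (σ i)),
      blockCost_le_blockCost hL hF hT ?_ (v := f (σ i)) (by simp [hff]) fun c hc => ?_⟩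
    · exact card_equiv σ (by simp)
    · rw [← show f (σ c) = f (σ i) from (mem_filter.1 hc).2]
      exact Fin.comp_perm_le_self_of_monotone hf σ hσ c

/-- Restricting the search to contiguous partitions loses nothing: the minimum makespan
over all partitions of `Fin n` into exactly `m` nonempty blocks equals the minimum
makespan over contiguous such partitions. -/
theorem min_makespan_eq_min_contiguous_makespan
    (n m : ℕ) (hn : 0 < n) (hm : 0 < m) (hmn : m ≤ n)
    (L : Fin n → ℝ) (hL : Antitone L)
    (F : ℕ → ℝ) (hFmono : Monotone F) (hFnonneg : ∀ k, 0 ≤ F k)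
    (T : ℝ) (hT : 0 ≤ T) :
    sInf {r : ℝ | ∃ P : Finpartition (univ : Finset (Fin n)),
        P.parts.card = m ∧ r = makespan L F T P} =
    sInf {r : ℝ | ∃ P : Finpartition (univ : Finset (Fin n)),
        P.parts.card = m ∧ Contiguous P ∧ r = makespan L F T P} := by
  set A := {r : ℝ | ∃ P : Finpartition (univ : Finset (Fin n)),
    P.parts.card = m ∧ r = makespan L F T P}
  set B := {r : ℝ | ∃ P : Finpartition (univ : Finset (Fin n)),
    P.parts.card = m ∧ Contiguous P ∧ r = makespan L F T P}
  have hBA : B ⊆ A := fun r ⟨P, hP, _, hr⟩ => ⟨P, hP, hr⟩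
  have hAB : ∀ r ∈ A, ∃ q ∈ B, q ≤ r := by
    rintro r ⟨P, hP, rfl⟩
    obtain ⟨Q, hcard, hQ, hle⟩ := exists_contiguous_makespan_le hL hFnonneg hT P
    exact ⟨_, ⟨Q, hcard.trans hP, hQ, rfl⟩, hle⟩
  have hA : BddBelow A := by
    refine ((Set.finite_range (makespan L F T)).subset ?_).bddBelow
    rintro r ⟨P, -, rfl⟩
    exact ⟨P, rfl⟩
  rcases A.eq_empty_or_nonempty with h | h
  · rw [h, Set.subset_empty_iff.1 (hBA.trans h.subset)]
  · obtain ⟨r, hr⟩ := h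
    obtain ⟨q, hq, -⟩ := hAB r hr
    refine le_antisymm (csInf_le_csInf hA ⟨q, hq⟩ hBA) (le_csInf ⟨r, hr⟩ fun s hs => ?_)
    obtain ⟨p, hp, hps⟩ := hAB s hs
    exact (csInf_le (hA.mono hBA) hp).trans hps
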